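/- arXiv:2309.10262 — 2 statements merged into one kernel-verified Lean document; each statement's English description precedes it below -/
import Mathlib

section
/- Let n ≥ 1, k : ℕ, let W be a submodule of V = Fin (N+1) → ℂ, and let C 1, …, C n be submodules of V. Then there exists a submodule P with P ≤ W, finrank P = k+1, and P ⊓ C i = ⊥ for all i, if and only if for every i, finrank (C i ⊓ W) + k + 1 ≤ finrank W. (Linear-algebraic core of the paper's Proposition 1.7 'image': a tuple of back-projected planes with common intersection H_{[n]} lies in the image of Φ_{C,k} iff every center c_i satisfies dim (c_i ∧ H_{[n]}) + k + 1 ≤ dim H_{[n]}.) -/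
open Module

/-- Over an infinite field, finitely many subspaces `D i` whose dimensions are at most
`finrank K W - m` can be avoided simultaneously by an `m`-dimensional subspace of `W`. -/
theorem Submodule.exists_le_finrank_eq_forall_disjoint {ι K V : Type*} [Finite ι] [Nonempty ι]
    [Field K] [Infinite K] [AddCommGroup V] [Module K V] [FiniteDimensional K V]
    (W : Submodule K V) (D : ι → Submodule K V) (m : ℕ)
    (h : ∀ i, finrank K (D i) + m ≤ finrank K W) :
    ∃ P ≤ W, finrank K P = m ∧ ∀ i, Disjoint P (D i) := by
  induction m with
  | zero => exact ⟨⊥, bot_le, finrank_bot K V, fun i => disjoint_bot_left⟩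
  | succ m ih =>
    obtain ⟨P, hPW, hPm, hPD⟩ := ih fun i => (Nat.le_succ _).trans (h i)
    obtain ⟨x, hx⟩ := Submodule.exists_forall_notMem_of_forall_ne_top
      (fun i => (P ⊔ D i).comap W.subtype) fun i hi => by
        have hW : W ≤ P ⊔ D i := Submodule.comap_subtype_eq_top.mp hi
        have h₁ := Submodule.finrank_mono hW
        have h₂ := Submodule.finrank_add_le_finrank_add_finrank P (D i)
        have h₃ := h i
        omega
    have hxP (i : ι) : (x : V) ∉ P ⊔ D i := hx i
    refine ⟨P ⊔ Submodule.span K {(x : V)}, ?_, ?_, fun i => ?_⟩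
    · exact sup_le hPW ((Submodule.span_singleton_le_iff_mem _ _).mpr x.2)
    · obtain ⟨i⟩ := ‹Nonempty ι›
      rw [Submodule.finrank_sup_span_singleton fun hmem =>
        hxP i (Submodule.mem_sup_left hmem), hPm]
    · rw [sup_comm]
      exact (hPD i).disjoint_sup_left_of_disjoint_sup_right
        (Submodule.disjoint_span_singleton_of_notMem (hxP i)).symm

/-- Linear-algebraic core of the **paper's Proposition 1.7 "image"**: inside a
subspace `W` there is a `(k+1)`-dimensional submodule `P` avoiding all the centers
`C i` iff every center satisfies `finrank (C i ⊓ W) + k + 1 ≤ finrank W`. -/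
theorem image_criterion (N k n : ℕ) (hn : 1 ≤ n)
    (W : Submodule ℂ (Fin (N + 1) → ℂ))
    (C : Fin n → Submodule ℂ (Fin (N + 1) → ℂ)) :
    (∃ P : Submodule ℂ (Fin (N + 1) → ℂ),
        P ≤ W ∧ finrank ℂ ↥P = k + 1 ∧ ∀ i, P ⊓ C i = ⊥) ↔
      ∀ i, finrank ℂ ↥(C i ⊓ W) + k + 1 ≤ finrank ℂ ↥W := by
  constructor
  · rintro ⟨P, hPW, hPk, hPC⟩ i
    have hinf : P ⊓ (C i ⊓ W) = ⊥ := by rw [← inf_assoc, hPC i, bot_inf_eq]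
    have hdim := Submodule.finrank_sup_add_finrank_inf_eq P (C i ⊓ W)
    rw [hinf, finrank_bot, hPk] at hdim
    have hle : finrank ℂ ↥(P ⊔ C i ⊓ W) ≤ finrank ℂ ↥W :=
      Submodule.finrank_mono (sup_le hPW inf_le_right)
    omega
  · intro h
    have : Nonempty (Fin n) := ⟨⟨0, hn⟩⟩
    obtain ⟨P, hPW, hPk, hPC⟩ :=
      Submodule.exists_le_finrank_eq_forall_disjoint W (fun i => C i ⊓ W) (k + 1) h
    refine ⟨P, hPW, hPk, fun i => ?_⟩
    rw [← (hPC i).eq_bot, inf_left_comm, inf_eq_left.mpr hPW, inf_comm]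
end

section
/- Let N, k : ℕ with k ≤ N, let n ≥ 1, and let h : Fin n → ℕ with k ≤ h i for all i; set Σ := Σ_i (h i − k) : ℕ and let τ : ℤ be the floor (Int.floor) of the real number ((N : ℝ) − 1 − Σ)/2 + Real.sqrt ( (k+1)·(N−k) + ( ((N : ℝ) − 1 − Σ)/2 − k )^2 ). Then τ ≥ k, and τ.toNat is the greatest element of the set { s : ℕ | ((s : ℤ) + 1)·((N : ℤ) − s) ≥ ((s : ℤ) − k)·(Σ : ℤ) }. (This is the computation, from the proof of the paper's Theorem 6.4 'uck', that the largest integer s with (s+1)(N−s) − (s−k)·Σ_i(h_i−k) ≥ 0 equals the bound τ_{N,h_i,k} of equation (6.2).) -/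
/-- Completing the square: the integer inequality says that `s` lies between the two roots
`a ± √D` of the quadratic, where `a = (N - 1 - S) / 2`. -/
theorem mul_le_mul_iff_abs_sub_le_sqrt {N k : ℤ} (hk₀ : 0 ≤ k) (hk : k ≤ N) (S s : ℤ) :
    (s - k) * S ≤ (s + 1) * (N - s) ↔
      |(s : ℝ) - ((N : ℝ) - 1 - S) / 2| ≤
        Real.sqrt (((k : ℝ) + 1) * ((N : ℝ) - k) + (((N : ℝ) - 1 - S) / 2 - k) ^ 2) := by
  have hcast : (s - k) * S ≤ (s + 1) * (N - s) ↔
      ((s : ℝ) - k) * S ≤ ((s : ℝ) + 1) * (N - s) := by exact_mod_cast Iff.rfl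
  have hsq : ((s : ℝ) - k) * S ≤ ((s : ℝ) + 1) * (N - s) ↔
      ((s : ℝ) - ((N : ℝ) - 1 - S) / 2) ^ 2 ≤
        ((k : ℝ) + 1) * ((N : ℝ) - k) + (((N : ℝ) - 1 - S) / 2 - k) ^ 2 := by
    constructor <;> intro hle <;> linarith
  rw [hcast, hsq]
  refine ⟨Real.abs_le_sqrt, fun hle => ?_⟩
  have hk₀' : (0 : ℝ) ≤ k := by exact_mod_cast hk₀
  have hk' : (0 : ℝ) ≤ (N : ℝ) - k := sub_nonneg.mpr (by exact_mod_cast hk)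
  rw [← sq_abs]
  exact (Real.le_sqrt (abs_nonneg _) (by positivity)).mp hle

/-- Computation from the proof of the **paper's Theorem 6.4 "uck"**: the largest
integer `s` with `(s+1)(N−s) − (s−k)·Σ_i(h_i−k) ≥ 0` equals the bound
`τ_{N,h_i,k} = ⌊(N−1−Σ)/2 + √((k+1)(N−k) + ((N−1−Σ)/2 − k)²)⌋`, and `τ ≥ k`. -/
theorem tau_greatest (N k n : ℕ) (hk : k ≤ N) (hn : 1 ≤ n)
    (h : Fin n → ℕ) (hh : ∀ i, k ≤ h i)
    (τ : ℤ)
    (hτ : τ = ⌊((N : ℝ) - 1 - ((∑ i, (h i - k) : ℕ) : ℝ)) / 2 +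
        Real.sqrt (((k : ℝ) + 1) * ((N : ℝ) - k) +
          (((N : ℝ) - 1 - ((∑ i, (h i - k) : ℕ) : ℝ)) / 2 - k) ^ 2)⌋) :
    (k : ℤ) ≤ τ ∧
      IsGreatest
        { s : ℕ | ((s : ℤ) + 1) * ((N : ℤ) - s) ≥
            ((s : ℤ) - k) * (((∑ i, (h i - k) : ℕ) : ℤ)) }
        τ.toNat := by
  have key := mul_le_mul_iff_abs_sub_le_sqrt (Int.natCast_nonneg k) (Int.ofNat_le.mpr hk)
    ((∑ i, (h i - k) : ℕ) : ℤ)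
  simp only [Int.cast_natCast, abs_le] at key
  have hmem_k := (key k).mp (by
    rw [sub_self, zero_mul]
    exact mul_nonneg (by positivity) (sub_nonneg.mpr (Int.ofNat_le.mpr hk)))
  have hkτ : (k : ℤ) ≤ τ := by
    rw [hτ, Int.le_floor]
    linarith [hmem_k.2]
  have hτ_le := (Int.le_floor (z := τ)).mp hτ.le
  refine ⟨hkτ, ?_, fun s hs => ?_⟩
  · have hτ_nat : ((τ.toNat : ℕ) : ℤ) = τ := Int.toNat_of_nonneg (by omega)
    rw [Set.mem_ofPred_eq, hτ_nat, ge_iff_le, key]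
    have hkτ' : ((k : ℤ) : ℝ) ≤ (τ : ℝ) := Int.cast_le.mpr hkτ
    constructor <;> linarith [hmem_k.1]
  · have hs_le := ((key s).mp hs).2
    have hsτ : (s : ℤ) ≤ τ := by
      rw [hτ, Int.le_floor]
      linarith
    omega
end
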